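/- Let n ≥ 1 and let Φ : (Fin n → ℝ*) → (Fin n → ℝ*) be an almost linear map on hyperreal vectors that maps finite vectors to finite vectors. Let T : (Fin n → ℝ) → (Fin n → ℝ) be its shadow, defined by T y = fun i => st (Φ (fun j => (y j : ℝ*)) i). Suppose there is a real d > 0 such that for every b : Fin n → ℝ with Euclidean norm ‖b‖ < d there exists a finite vector ξ with Φ ξ = (fun i => (b i : ℝ*)). Then T is an ℝ-linear bijection of Fin n → ℝ onto itself. -/

import Mathlib

/-- A vector of hyperreals is finite if every component is finite (not infinite). -/
def HyperVecFinite {m : ℕ} (v : Fin m → ℝ*) : Prop :=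
  ∀ i, ¬ Hyperreal.Infinite (v i)

/-- A map on hyperreal vectors is almost linear if it respects linear combinations with
finite scalar coefficients of finite vectors up to infinitesimals, componentwise. -/
def HyperAlmostLinear {m n : ℕ} (Φ : (Fin m → ℝ*) → (Fin n → ℝ*)) : Prop :=
  ∀ α β : ℝ*, ¬ Hyperreal.Infinite α → ¬ Hyperreal.Infinite β →
    ∀ v w : Fin m → ℝ*, HyperVecFinite v → HyperVecFinite w →
      ∀ i, Hyperreal.Infinitesimal
        (Φ (α • v + β • w) i - (α • Φ v + β • Φ w) i)

set_option linter.deprecated false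

/-- The standard part turns an infinitesimal difference from a finite hyperreal into an equality. -/
theorem Hyperreal.st_eq_of_infinitesimal_sub {x y : ℝ*} (hy : ¬ Hyperreal.Infinite y)
    (h : Hyperreal.Infinitesimal (x - y)) : Hyperreal.st x = Hyperreal.st y := by
  have hst := (show Hyperreal.IsSt (x - y) 0 from h).add (Hyperreal.isSt_st' hy)
  rw [sub_add_cancel, zero_add] at hst
  exact hst.st_eq

theorem HyperVecFinite.coe {m : ℕ} (y : Fin m → ℝ) :
    HyperVecFinite (fun j => (y j : ℝ*)) :=
  fun j => Hyperreal.not_infinite_real (y j)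

theorem HyperVecFinite.zero {m : ℕ} : HyperVecFinite (0 : Fin m → ℝ*) :=
  fun _ => Hyperreal.not_infinite_zero

theorem HyperVecFinite.smul {m : ℕ} {α : ℝ*} {v : Fin m → ℝ*} (hα : ¬ Hyperreal.Infinite α)
    (hv : HyperVecFinite v) : HyperVecFinite (α • v) :=
  fun j => Hyperreal.not_infinite_mul hα (hv j)

theorem HyperVecFinite.add {m : ℕ} {v w : Fin m → ℝ*} (hv : HyperVecFinite v)
    (hw : HyperVecFinite w) : HyperVecFinite (v + w) :=
  fun j => Hyperreal.not_infinite_add (hv j) (hw j)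

theorem HyperVecFinite.sum {m : ℕ} {ι : Type*} (s : Finset ι) {f : ι → Fin m → ℝ*}
    (hf : ∀ k ∈ s, HyperVecFinite (f k)) : HyperVecFinite (∑ k ∈ s, f k) :=
  Finset.sum_induction f HyperVecFinite (fun _ _ => HyperVecFinite.add) HyperVecFinite.zero hf

theorem HyperVecFinite.single_one {m : ℕ} (k : Fin m) :
    HyperVecFinite (Pi.single k (1 : ℝ*)) := by
  intro j
  rcases eq_or_ne j k with rfl | h
  · simpa using Hyperreal.not_infinite_real 1
  · simpa [h] using Hyperreal.not_infinite_zero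

namespace HyperAlmostLinear

variable {m n : ℕ} {Φ : (Fin m → ℝ*) → (Fin n → ℝ*)}

theorem st_add_smul (hal : HyperAlmostLinear Φ)
    (hfin : ∀ v, HyperVecFinite v → HyperVecFinite (Φ v)) {α β : ℝ*}
    (hα : ¬ Hyperreal.Infinite α) (hβ : ¬ Hyperreal.Infinite β) {v w : Fin m → ℝ*}
    (hv : HyperVecFinite v) (hw : HyperVecFinite w) (i : Fin n) :
    Hyperreal.st (Φ (α • v + β • w) i) =
      Hyperreal.st α * Hyperreal.st (Φ v i) + Hyperreal.st β * Hyperreal.st (Φ w i) := by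
  have hαv := (hfin v hv).smul hα
  have hβw := (hfin w hw).smul hβ
  rw [Hyperreal.st_eq_of_infinitesimal_sub (hαv.add hβw i) (hal α β hα hβ v w hv hw i),
    Pi.add_apply, Hyperreal.st_add (hαv i) (hβw i), Pi.smul_apply, Pi.smul_apply, smul_eq_mul,
    smul_eq_mul, Hyperreal.st_mul hα (hfin v hv i), Hyperreal.st_mul hβ (hfin w hw i)]

theorem st_sum_smul (hal : HyperAlmostLinear Φ)
    (hfin : ∀ v, HyperVecFinite v → HyperVecFinite (Φ v)) {ι : Type*} (s : Finset ι)
    {c : ι → ℝ*} (hc : ∀ k, ¬ Hyperreal.Infinite (c k)) {e : ι → Fin m → ℝ*}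
    (he : ∀ k, HyperVecFinite (e k)) (i : Fin n) :
    Hyperreal.st (Φ (∑ k ∈ s, c k • e k) i) =
      ∑ k ∈ s, Hyperreal.st (c k) * Hyperreal.st (Φ (e k) i) := by
  classical
  have st_zero : Hyperreal.st 0 = 0 := Hyperreal.st_id_real 0
  have st_one : Hyperreal.st 1 = 1 := Hyperreal.st_id_real 1
  induction s using Finset.induction_on with
  | empty =>
    have h := hal.st_add_smul hfin Hyperreal.not_infinite_zero Hyperreal.not_infinite_zero
      HyperVecFinite.zero HyperVecFinite.zero i
    simpa [st_zero] using h
  | insert a s ha ih =>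
    have h := hal.st_add_smul hfin (hc a) (Hyperreal.not_infinite_real 1) (he a)
      (HyperVecFinite.sum s fun k _ => (he k).smul (hc k)) i
    rw [Finset.sum_insert ha, Finset.sum_insert ha, ← ih]
    simpa [st_one] using h

/-- Up to infinitesimals, an almost linear map sees only the standard part of a finite vector. -/
theorem st_apply_eq_st_apply_coe_st (hal : HyperAlmostLinear Φ)
    (hfin : ∀ v, HyperVecFinite v → HyperVecFinite (Φ v)) {ξ : Fin m → ℝ*}
    (hξ : HyperVecFinite ξ) (i : Fin n) :
    Hyperreal.st (Φ ξ i) = Hyperreal.st (Φ (fun j => (Hyperreal.st (ξ j) : ℝ*)) i) := by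
  have expand (v : Fin m → ℝ*) (hv : HyperVecFinite v) :=
    hal.st_sum_smul hfin Finset.univ hv HyperVecFinite.single_one i
  simp only [← pi_eq_sum_univ'] at expand
  rw [expand ξ hξ, expand _ (HyperVecFinite.coe _)]
  simp only [Hyperreal.st_id_real]

theorem isLinearMap_shadow (hal : HyperAlmostLinear Φ)
    (hfin : ∀ v, HyperVecFinite v → HyperVecFinite (Φ v)) :
    IsLinearMap ℝ fun (y : Fin m → ℝ) i => Hyperreal.st (Φ (fun j => (y j : ℝ*)) i) := by
  have comb (a b : ℝ) (y z : Fin m → ℝ) (i : Fin n) :=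
    hal.st_add_smul hfin (Hyperreal.not_infinite_real a) (Hyperreal.not_infinite_real b)
      (HyperVecFinite.coe y) (HyperVecFinite.coe z) i
  simp only [Hyperreal.st_id_real] at comb
  constructor
  · intro y z
    funext i
    simpa [Pi.add_def] using comb 1 1 y z i
  · intro a y
    funext i
    simpa [Pi.smul_def] using comb a 0 y 0 i

end HyperAlmostLinear

/-- A linear map whose range contains a ball around the origin is surjective. -/
theorem LinearMap.surjective_of_ball_subset_range {E F : Type*} [AddCommGroup E] [Module ℝ E]
    [SeminormedAddCommGroup F] [NormedSpace ℝ F] (L : E →ₗ[ℝ] F) {d : ℝ} (hd : 0 < d)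
    (h : ∀ b : F, ‖b‖ < d → b ∈ Set.range L) : Function.Surjective L := by
  intro y
  have hy : 0 < ‖y‖ + 1 := by positivity
  have hc : 0 < d / (‖y‖ + 1) := div_pos hd hy
  obtain ⟨x, hx⟩ := h ((d / (‖y‖ + 1)) • y) (by
    rw [norm_smul, Real.norm_of_nonneg hc.le, div_mul_eq_mul_div, div_lt_iff₀ hy]
    nlinarith)
  exact ⟨(d / (‖y‖ + 1))⁻¹ • x, by rw [map_smul, hx, inv_smul_smul₀ hc.ne']⟩

/-- Part (iii) of Lemma 1.2: if an almost linear map `Φ` on hyperreal vectors (sending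
finite vectors to finite vectors) has range containing all standard points of a ball of
positive standard radius `d` (in the Euclidean norm), then its shadow `T` is a linear
bijection. -/
theorem almost_linear_onto_ball_shadow_bijective (n : ℕ) (hn : 1 ≤ n)
    (Φ : (Fin n → ℝ*) → (Fin n → ℝ*))
    (hfin : ∀ v : Fin n → ℝ*, HyperVecFinite v → HyperVecFinite (Φ v))
    (hal : HyperAlmostLinear Φ)
    (T : (Fin n → ℝ) → (Fin n → ℝ))
    (hT : T = fun y => fun i => Hyperreal.st (Φ (fun j => ((y j : ℝ) : ℝ*)) i))
    (d : ℝ) (hd : 0 < d)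
    (hsurj : ∀ b : Fin n → ℝ, ‖(WithLp.equiv 2 (Fin n → ℝ)).symm b‖ < d →
      ∃ ξ : Fin n → ℝ*, HyperVecFinite ξ ∧ Φ ξ = fun i => ((b i : ℝ) : ℝ*)) :
    IsLinearMap ℝ T ∧ Function.Bijective T := by
  have hlin : IsLinearMap ℝ T := hT ▸ hal.isLinearMap_shadow hfin
  let L := hlin.mk' T
  have hsurjE : Function.Surjective
      ((WithLp.linearEquiv 2 ℝ (Fin n → ℝ)).symm.toLinearMap ∘ₗ L) := by
    refine LinearMap.surjective_of_ball_subset_range _ hd fun b hb => ?_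
    obtain ⟨ξ, hξ, hΦξ⟩ := hsurj (WithLp.ofLp b) hb
    refine ⟨fun j => Hyperreal.st (ξ j), ?_⟩
    have hTξ : T (fun j => Hyperreal.st (ξ j)) = WithLp.ofLp b := by
      funext i
      simp only [hT]
      rw [← hal.st_apply_eq_st_apply_coe_st hfin hξ i, hΦξ, Hyperreal.st_id_real]
    exact congrArg (WithLp.toLp 2) hTξ
  have hTsurj : Function.Surjective L := by
    intro y
    obtain ⟨x, hx⟩ := hsurjE (WithLp.toLp 2 y)
    exact ⟨x, congrArg WithLp.ofLp hx⟩
  exact ⟨hlin, LinearMap.injective_iff_surjective.mpr hTsurj, hTsurj⟩
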